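/- Main theorem (uniform model): For 1 ≤ n ≤ 2^d, let U be a uniformly random n-element subset of {0,1}^d and Q = conv(U). Then, with probability tending to 1 as d → ∞ (uniformly over n), the edge expansion of the graph of Q is at least 1/(12d). -/

import Mathlib

open scoped BigOperators Classical

/-- A face of `P ⊆ ℝ^d`: the subset of `P` where a linear functional valid on `P`
attains the value `c₀`. -/
def IsFaceOf {d : ℕ} (P F : Set (Fin d → ℝ)) : Prop :=
  ∃ (c : Fin d → ℝ) (c₀ : ℝ), (∀ x ∈ P, ∑ i, c i * x i ≤ c₀) ∧
    F = {x ∈ P | ∑ i, c i * x i = c₀}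

/-- A vertex of `P` is a point whose singleton is a face of `P`. -/
def IsVertexOf {d : ℕ} (P : Set (Fin d → ℝ)) (v : Fin d → ℝ) : Prop := IsFaceOf P {v}

/-- An edge of `P` is a segment between two distinct points that is a face of `P`. -/
def IsEdgeOf {d : ℕ} (P : Set (Fin d → ℝ)) (u v : Fin d → ℝ) : Prop :=
  u ≠ v ∧ IsFaceOf P (segment ℝ u v)

/-- The vertex set of `P`. -/
def polyVerts {d : ℕ} (P : Set (Fin d → ℝ)) : Set (Fin d → ℝ) := {v | IsVertexOf P v}

/-- The number of edges of `P` with exactly one endpoint in `S`, counted as ordered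
pairs `(u, v)` with `u ∈ S` and `v ∉ S`, so each crossing edge is counted once. -/
noncomputable def cutCard {d : ℕ} (P S : Set (Fin d → ℝ)) : ℕ :=
  {e : (Fin d → ℝ) × (Fin d → ℝ) | IsEdgeOf P e.1 e.2 ∧ e.1 ∈ S ∧ e.2 ∉ S}.ncard

/-- The edge expansion of the graph of `P` is at least `α`. -/
def ExpansionAtLeast {d : ℕ} (P : Set (Fin d → ℝ)) (α : ℝ) : Prop :=
  ∀ S : Set (Fin d → ℝ), S ⊆ polyVerts P → S.Nonempty →
    2 * S.ncard ≤ (polyVerts P).ncard → α * S.ncard ≤ cutCard P S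

/-- The embedding of `{0,1}^d` (as `Fin d → Fin 2`) into `ℝ^d`. -/
def toCube {d : ℕ} (w : Fin d → Fin 2) : Fin d → ℝ := fun i => ((w i : ℕ) : ℝ)

section Geometry

variable {d : ℕ}

/-- Adjoining a convex piece of the bounding hyperplane to an open half-space keeps it convex. -/
theorem convex_openHalfSpace_union (c : Fin d → ℝ) (c₀ : ℝ) {K : Set (Fin d → ℝ)}
    (hK : Convex ℝ K) (hKc : ∀ x ∈ K, ∑ i, c i * x i = c₀) :
    Convex ℝ ({x : Fin d → ℝ | ∑ i, c i * x i < c₀} ∪ K) := by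
  have hlin : ∀ (a b : ℝ) (x y : Fin d → ℝ),
      ∑ i, c i * (a • x + b • y) i = a * ∑ i, c i * x i + b * ∑ i, c i * y i := by
    intro a b x y
    simp only [Pi.add_apply, Pi.smul_apply, smul_eq_mul, Finset.mul_sum, ← Finset.sum_add_distrib]
    exact Finset.sum_congr rfl fun i _ => by ring
  intro x hx y hy a b ha hb hab
  rcases hx with hx | hx <;> rcases hy with hy | hy
  · left
    simp only [Set.mem_ofPred_eq] at hx hy ⊢
    rw [hlin]
    rcases ha.eq_or_lt with rfl | ha
    · have : b = 1 := by linarith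
      subst this; linarith
    · have : a * (∑ i, c i * x i) < a * c₀ := by gcongr
      have : b * (∑ i, c i * y i) ≤ b * c₀ := by gcongr
      have : a * c₀ + b * c₀ = c₀ := by rw [← add_mul, hab, one_mul]
      linarith
  · rcases ha.eq_or_lt with rfl | ha
    · have : b = 1 := by linarith
      subst this; right; simpa using hy
    · left
      simp only [Set.mem_ofPred_eq] at hx ⊢
      rw [hlin, hKc y hy]
      have : a * (∑ i, c i * x i) < a * c₀ := by gcongr
      have : a * c₀ + b * c₀ = c₀ := by rw [← add_mul, hab, one_mul]
      linarith
  · rcases hb.eq_or_lt with rfl | hb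
    · have : a = 1 := by linarith
      subst this; right; simpa using hx
    · left
      simp only [Set.mem_ofPred_eq] at hy ⊢
      rw [hlin, hKc x hx]
      have : b * (∑ i, c i * y i) < b * c₀ := by gcongr
      have : a * c₀ + b * c₀ = c₀ := by rw [← add_mul, hab, one_mul]
      linarith
  · exact Or.inr (hK hx hy ha hb hab)

theorem isFaceOf_convexHull {X K : Set (Fin d → ℝ)} (c : Fin d → ℝ) (c₀ : ℝ)
    (hK : Convex ℝ K) (hKc : ∀ x ∈ K, ∑ i, c i * x i = c₀) (hKX : K ⊆ convexHull ℝ X)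
    (hX : ∀ x ∈ X, ∑ i, c i * x i < c₀ ∨ x ∈ K) : IsFaceOf (convexHull ℝ X) K := by
  have hsub : convexHull ℝ X ⊆ {x : Fin d → ℝ | ∑ i, c i * x i < c₀} ∪ K :=
    convexHull_min hX (convex_openHalfSpace_union c c₀ hK hKc)
  refine ⟨c, c₀, fun x hx => ?_, ?_⟩
  · rcases hsub hx with h | h
    · exact le_of_lt h
    · exact (hKc x h).le
  · ext x
    refine ⟨fun h => ⟨hKX h, hKc x h⟩, fun h => ?_⟩
    rcases hsub h.1 with h' | h'
    · exact absurd h.2 (ne_of_lt h')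
    · exact h'

theorem IsVertexOf.mem_of_convexHull {X : Set (Fin d → ℝ)} {v : Fin d → ℝ}
    (h : IsVertexOf (convexHull ℝ X) v) : v ∈ X := by
  obtain ⟨c, c₀, hle, hF⟩ := h
  have hv : v ∈ {x ∈ convexHull ℝ X | ∑ i, c i * x i = c₀} := hF ▸ rfl
  by_contra hvX
  have hsub : convexHull ℝ X ⊆ {x : Fin d → ℝ | ∑ i, c i * x i < c₀} ∪ ∅ := by
    refine convexHull_min (fun x hx => Or.inl ?_)
      (convex_openHalfSpace_union c c₀ convex_empty (by simp))
    have hxP := subset_convexHull ℝ X hx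
    refine lt_of_le_of_ne (hle x hxP) fun heq => hvX ?_
    have : x ∈ ({v} : Set (Fin d → ℝ)) := by rw [hF]; exact ⟨hxP, heq⟩
    rwa [Set.mem_singleton_iff.1 this] at hx
  rcases hsub hv.1 with h' | h'
  · exact absurd hv.2 (ne_of_lt h')
  · exact h'

theorem dot_lt_of_mem_segment {u v x : Fin d → ℝ} (hx : x ∈ segment ℝ u v) (hxv : x ≠ v) :
    ∑ i, (v i - u i) * x i < ∑ i, (v i - u i) * v i := by
  obtain ⟨a, b, ha, hb, hab, rfl⟩ := hx
  have hb1 : b = 1 - a := by linarith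
  subst hb1
  have ha0 : 0 < a := ha.lt_of_ne fun h => hxv (by simp [← h])
  have hne : u ≠ v := fun h => hxv (by rw [h, ← add_smul]; simp)
  obtain ⟨j, hj⟩ := Function.ne_iff.1 hne
  have hpos : 0 < ∑ i, (v i - u i) ^ 2 :=
    Finset.sum_pos' (fun i _ => sq_nonneg _)
      ⟨j, Finset.mem_univ _, by have := sub_ne_zero.2 hj.symm; positivity⟩
  have : ∑ i, (v i - u i) * v i - ∑ i, (v i - u i) * (a • u + (1 - a) • v) i
      = a * ∑ i, (v i - u i) ^ 2 := by
    rw [← Finset.sum_sub_distrib, Finset.mul_sum]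
    refine Finset.sum_congr rfl fun i _ => ?_
    simp only [Pi.add_apply, Pi.smul_apply, smul_eq_mul]
    ring
  nlinarith [mul_pos ha0 hpos]

theorem IsEdgeOf.symm {P : Set (Fin d → ℝ)} {u v : Fin d → ℝ} (h : IsEdgeOf P u v) :
    IsEdgeOf P v u :=
  ⟨h.1.symm, by rw [segment_symm]; exact h.2⟩

theorem IsEdgeOf.right_mem_of_convexHull {X : Set (Fin d → ℝ)} {u v : Fin d → ℝ}
    (h : IsEdgeOf (convexHull ℝ X) u v) : v ∈ X := by
  obtain ⟨-, c, c₀, hle, hF⟩ := h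
  have hv : v ∈ {x ∈ convexHull ℝ X | ∑ i, c i * x i = c₀} :=
    hF ▸ right_mem_segment ℝ u v
  by_contra hvX
  let K := segment ℝ u v ∩
    {x : Fin d → ℝ | ∑ i, (v i - u i) * x i < ∑ i, (v i - u i) * v i}
  have hKconv : Convex ℝ K := by
    refine (convex_segment u v).inter ?_
    simpa using convex_openHalfSpace_union (fun i => v i - u i)
      (∑ i, (v i - u i) * v i) convex_empty (by simp)
  have hsub : convexHull ℝ X ⊆ {x : Fin d → ℝ | ∑ i, c i * x i < c₀} ∪ K := by
    refine convexHull_min (fun x hx => ?_)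
      (convex_openHalfSpace_union c c₀ hKconv fun x hx => ?_)
    · have hxP := subset_convexHull ℝ X hx
      rcases (hle x hxP).lt_or_eq with hlt | heq
      · exact Or.inl hlt
      · have hxs : x ∈ segment ℝ u v := by rw [hF]; exact ⟨hxP, heq⟩
        exact Or.inr ⟨hxs, dot_lt_of_mem_segment hxs fun h => hvX (h ▸ hx)⟩
    · have := hx.1
      rw [hF] at this
      exact this.2
  rcases hsub hv.1 with h' | h'
  · exact absurd hv.2 (ne_of_lt h')
  · exact absurd h'.2 (by simp)

theorem toCube_injective : Function.Injective (toCube : (Fin d → Fin 2) → Fin d → ℝ) := by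
  intro u v h
  funext i
  have := congrFun h i
  simp only [toCube, Nat.cast_inj] at this
  exact Fin.ext this

/-- `σ_u` with `∑ i, σ_u i * (x i - u i)` the Hamming distance from `u` to `x`. -/
def cubeSign (u : Fin d → Fin 2) (i : Fin d) : ℝ := 1 - 2 * toCube u i

theorem cubeSign_mul_sub (u x : Fin d → Fin 2) (i : Fin d) :
    cubeSign u i * (toCube x i - toCube u i) = if x i = u i then 0 else 1 := by
  unfold cubeSign toCube
  generalize x i = a
  generalize u i = b
  fin_cases a <;> fin_cases b <;> norm_num

theorem sum_cubeSign_mul_sub (u x : Fin d → Fin 2) :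
    ∑ i, cubeSign u i * (toCube x i - toCube u i) = hammingDist x u := by
  simp [cubeSign_mul_sub, hammingDist, Finset.sum_ite]

theorem dot_cubeSign_lt {u x : Fin d → Fin 2} (h : x ≠ u) :
    ∑ i, cubeSign u i * toCube u i < ∑ i, cubeSign u i * toCube x i := by
  have h1 := sum_cubeSign_mul_sub u x
  have h2 : (0 : ℝ) < hammingDist x u := by exact_mod_cast hammingDist_pos.2 h
  simp only [mul_sub, Finset.sum_sub_distrib] at h1
  linarith

theorem polyVerts_convexHull_toCube (U : Set (Fin d → Fin 2)) :
    polyVerts (convexHull ℝ (toCube '' U)) = toCube '' U := by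
  refine Set.Subset.antisymm (fun v hv => IsVertexOf.mem_of_convexHull hv) ?_
  rintro _ ⟨u, hu, rfl⟩
  refine isFaceOf_convexHull (fun i => -cubeSign u i) (∑ i, -cubeSign u i * toCube u i)
    (convex_singleton _) (by rintro _ rfl; rfl)
    (Set.singleton_subset_iff.2 (subset_convexHull ℝ _ ⟨u, hu, rfl⟩)) ?_
  rintro _ ⟨x, hx, rfl⟩
  by_cases h : x = u
  · right; simp [h]
  · left
    have := dot_cubeSign_lt h
    simp only [neg_mul, Finset.sum_neg_distrib]
    linarith

theorem isEdgeOf_convexHull_toCube {U : Set (Fin d → Fin 2)} {u v : Fin d → Fin 2}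
    (hu : u ∈ U) (hv : v ∈ U) (huv : u ≠ v) (c : Fin d → ℝ)
    (hc : ∑ i, c i * (toCube v i - toCube u i) = 0)
    (hlt : ∀ x ∈ U, x ≠ u → x ≠ v → ∑ i, c i * (toCube x i - toCube u i) < 0) :
    IsEdgeOf (convexHull ℝ (toCube '' U)) (toCube u) (toCube v) := by
  have hmem : ∀ w ∈ U, toCube w ∈ convexHull ℝ (toCube '' U) := fun w hw =>
    subset_convexHull ℝ _ ⟨w, hw, rfl⟩
  simp only [mul_sub, Finset.sum_sub_distrib] at hc hlt
  refine ⟨toCube_injective.ne huv, isFaceOf_convexHull c (∑ i, c i * toCube u i)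
    (convex_segment _ _) ?_ ((convex_convexHull ℝ _).segment_subset (hmem u hu) (hmem v hv)) ?_⟩
  · rintro _ ⟨a, b, -, -, hab, rfl⟩
    have : ∑ i, c i * (a • toCube u + b • toCube v) i
        = a * ∑ i, c i * toCube u i + b * ∑ i, c i * toCube v i := by
      simp only [Pi.add_apply, Pi.smul_apply, smul_eq_mul, Finset.mul_sum,
        ← Finset.sum_add_distrib]
      exact Finset.sum_congr rfl fun i _ => by ring
    rw [this, sub_eq_zero.1 hc, ← add_mul, hab, one_mul]
  · rintro _ ⟨x, hx, rfl⟩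
    by_cases h1 : x = u
    · exact Or.inr (h1 ▸ left_mem_segment ℝ _ _)
    by_cases h2 : x = v
    · exact Or.inr (h2 ▸ right_mem_segment ℝ _ _)
    · exact Or.inl (by linarith [hlt x hx h1 h2])

/-- Within a face `F` of the cube, a vertex of `conv U` which does not maximize a linear
functional `l` over `U ∩ F` has a neighbour in `F` with a larger value of `l`. -/
theorem exists_improving_edge {U : Finset (Fin d → Fin 2)} {F : (Fin d → Fin 2) → Prop}
    (hF : ∀ u v x, F u → F v → (∀ i, x i = u i ∨ x i = v i) → F x)
    {u y : Fin d → Fin 2} (hu : u ∈ U) (hFu : F u) (hy : y ∈ U) (hFy : F y) (l : Fin d → ℝ)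
    (hl : 0 < ∑ i, l i * (toCube y i - toCube u i)) :
    ∃ v ∈ U, F v ∧ 0 < ∑ i, l i * (toCube v i - toCube u i) ∧
      IsEdgeOf (convexHull ℝ (toCube '' (U : Set (Fin d → Fin 2)))) (toCube u) (toCube v) := by
  set L : (Fin d → Fin 2) → ℝ := fun x => ∑ i, l i * (toCube x i - toCube u i) with hL
  have hyu : y ≠ u := by rintro rfl; simp at hl
  have hdpos : ∀ x, x ≠ u → (0 : ℝ) < hammingDist x u := fun x hx => by
    exact_mod_cast hammingDist_pos.2 hx
  obtain ⟨z₀, hz₀, hmax⟩ := (U.filter fun x => F x ∧ x ≠ u).exists_max_image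
    (fun x => L x / hammingDist x u) ⟨y, by simp [hy, hFy, hyu]⟩
  set r := L z₀ / hammingDist z₀ u with hr
  have hrpos : 0 < r :=
    lt_of_lt_of_le (div_pos hl (hdpos y hyu)) (hmax y (by simp [hy, hFy, hyu]))
  obtain ⟨z, hz, hmin⟩ := Finset.exists_min_image
    (U.filter fun x => F x ∧ x ≠ u ∧ L x = r * hammingDist x u) (fun x => hammingDist x u) ⟨z₀, by
      simp only [Finset.mem_filter] at hz₀ ⊢
      refine ⟨hz₀.1, hz₀.2.1, hz₀.2.2, ?_⟩
      rw [hr, div_mul_cancel₀ _ (hdpos z₀ hz₀.2.2).ne']⟩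
  simp only [Finset.mem_filter] at hz hmin hmax
  obtain ⟨hzU, hFz, hzu, hLz⟩ := hz
  have hLzpos : 0 < L z := hLz ▸ mul_pos hrpos (hdpos z hzu)
  refine ⟨z, hzU, hFz, hLzpos, ?_⟩
  -- penalize the coordinates where `z` agrees with `u`
  let C : ℝ := ∑ i, |l i| + 1
  let g : (Fin d → Fin 2) → ℝ := fun x => ∑ i, if z i = u i ∧ x i ≠ u i then 1 else 0
  have hexp : ∀ x, ∑ i, (l i - r * cubeSign u i - C * if z i = u i then cubeSign u i else 0) *
      (toCube x i - toCube u i) = L x - r * hammingDist x u - C * g x := by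
    intro x
    rw [← sum_cubeSign_mul_sub u x]
    simp only [hL, g, Finset.mul_sum, ← Finset.sum_sub_distrib]
    refine Finset.sum_congr rfl fun i _ => ?_
    have := cubeSign_mul_sub u x i
    by_cases h1 : z i = u i
    · simp only [h1, if_true, true_and, ne_eq, ite_not]
      linear_combination -C * this
    · simp only [h1, if_false, false_and]
      ring
  refine isEdgeOf_convexHull_toCube (Finset.mem_coe.2 hu) (Finset.mem_coe.2 hzU) hzu.symm _
    ((hexp z).trans ?_) fun x hx hxu hxz => (hexp x).trans_lt ?_
  · have : g z = 0 := Finset.sum_eq_zero fun i _ => by simp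
    rw [this, hLz]; ring
  · by_cases hxb : ∃ i, z i = u i ∧ x i ≠ u i
    · obtain ⟨j, hj⟩ := hxb
      have hg : 1 ≤ g x := by
        have := Finset.single_le_sum (f := fun i => if z i = u i ∧ x i ≠ u i then (1 : ℝ) else 0)
          (fun i _ => by positivity) (Finset.mem_univ j)
        simpa only [if_pos hj] using this
      have hLx : L x ≤ ∑ i, |l i| := by
        refine Finset.sum_le_sum fun i _ => (le_abs_self _).trans ?_
        rw [abs_mul]
        refine mul_le_of_le_one_right (abs_nonneg _) ?_
        unfold toCube
        generalize x i = a
        generalize u i = b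
        fin_cases a <;> fin_cases b <;> norm_num
      have hCpos : 0 ≤ C := by positivity
      have := mul_pos hrpos (hdpos x hxu)
      have : C * 1 ≤ C * g x := by gcongr
      simp only [C] at *
      linarith
    · push Not at hxb
      have hFx : F x := hF u z x hFu hFz fun i => by
        by_cases h : z i = u i
        · exact Or.inl (hxb i h)
        · have h2 : ∀ a b c : Fin 2, a ≠ b → c = b ∨ c = a := by decide
          exact h2 _ _ _ h
      have hg : 0 ≤ C * g x := by positivity
      have hle : L x ≤ r * hammingDist x u :=
        (div_le_iff₀ (hdpos x hxu)).1 (hmax x ⟨hx, hFx, hxu⟩)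
      rcases hle.lt_or_eq with h | h
      · linarith
      · exfalso
        have hm := hmin x ⟨hx, hFx, hxu, h⟩
        apply hxz
        have hsub : (Finset.univ.filter fun i => x i ≠ u i) ⊆
            Finset.univ.filter fun i => z i ≠ u i := by
          intro i
          simp only [Finset.mem_filter, Finset.mem_univ, true_and]
          exact fun h1 h2 => h1 (hxb i h2)
        have heq := Finset.eq_of_subset_of_card_le hsub hm
        funext i
        have hi : x i ≠ u i ↔ z i ≠ u i := by
          have := congrArg (i ∈ ·) heq
          simpa using this
        have h2 : ∀ a b c : Fin 2, (a ≠ b ↔ c ≠ b) → a = c := by decide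
        exact h2 _ _ _ hi

end Geometry

section Hypercube

variable {m : ℕ}

/-- The neighbour of `x` in the hypercube along coordinate `i`. -/
def flipAt (x : Fin m → Fin 2) (i : Fin m) : Fin m → Fin 2 := Function.update x i (x i + 1)

theorem flipAt_flipAt (x : Fin m → Fin 2) (i : Fin m) : flipAt (flipAt x i) i = x := by
  have h : ∀ a : Fin 2, a + 1 + 1 = a := by decide
  simp [flipAt, h]

theorem flipAt_apply_ne (x : Fin m → Fin 2) (i : Fin m) : flipAt x i i ≠ x i := by
  have h : ∀ a : Fin 2, a + 1 ≠ a := by decide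
  simp [flipAt, h]

theorem flipAt_ne (x : Fin m → Fin 2) (i : Fin m) : flipAt x i ≠ x :=
  fun h => flipAt_apply_ne x i (congrFun h i)

theorem flipAt_left_injective (x : Fin m → Fin 2) : Function.Injective (flipAt x) := by
  intro i j h
  by_contra hij
  refine flipAt_apply_ne x i ?_
  rw [h, flipAt, Function.update_of_ne hij]

theorem eq_flipAt {x y : Fin m → Fin 2} {i : Fin m} (hi : y i ≠ x i)
    (h : ∀ j, j ≠ i → y j = x j) : y = flipAt x i := by
  funext j
  by_cases hj : j = i
  · subst hj
    have h2 : ∀ a b : Fin 2, a ≠ b → a = b + 1 := by decide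
    simpa [flipAt] using h2 _ _ hi
  · rw [h j hj, flipAt, Function.update_of_ne hj]

theorem sum_cube_succ (f : (Fin (m + 1) → Fin 2) → ℝ) :
    ∑ x, f x = ∑ y : Fin m → Fin 2,
      (f (Fin.cons (α := fun _ => Fin 2) 0 y) + f (Fin.cons (α := fun _ => Fin 2) 1 y)) := by
  rw [← (Fin.consEquiv fun _ : Fin (m + 1) => Fin 2).sum_comp, Fintype.sum_prod_type,
    Fin.sum_univ_two, ← Finset.sum_add_distrib]
  rfl

/-- The Poincaré inequality on the hypercube. -/
theorem poincare_cube (f : (Fin m → Fin 2) → ℝ) :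
    2 ^ m * ∑ x, f x ^ 2 - (∑ x, f x) ^ 2 ≤
      2 ^ m / 4 * ∑ x, ∑ i, (f x - f (flipAt x i)) ^ 2 := by
  induction m with
  | zero => simp
  | succ m ih =>
    have h0 := ih fun y => f (Fin.cons (α := fun _ => Fin 2) 0 y)
    have h1 := ih fun y => f (Fin.cons (α := fun _ => Fin 2) 1 y)
    have hz : ∀ (a : Fin 2) (y : Fin m → Fin 2),
        flipAt (Fin.cons (α := fun _ => Fin 2) a y) 0
          = Fin.cons (α := fun _ => Fin 2) (a + 1) y := by
      intro a y
      simp [flipAt]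
    have hs : ∀ (a : Fin 2) (y : Fin m → Fin 2) (i : Fin m),
        flipAt (Fin.cons (α := fun _ => Fin 2) a y) i.succ
          = Fin.cons (α := fun _ => Fin 2) a (flipAt y i) := by
      intro a y i
      simp [flipAt, Fin.cons_update]
    have h01 : (0 : Fin 2) + 1 = 1 := rfl
    have h10 : (1 : Fin 2) + 1 = 0 := rfl
    simp only [sum_cube_succ, Fin.sum_univ_succ, hz, hs, h01, h10, Finset.sum_add_distrib]
    set f0 := fun y => f (Fin.cons (α := fun _ => Fin 2) 0 y)
    set f1 := fun y => f (Fin.cons (α := fun _ => Fin 2) 1 y)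
    have hcs := sq_sum_le_card_mul_sum_sq (s := Finset.univ) (f := fun y => f0 y - f1 y)
    have hsymm : ∑ y, (f1 y - f0 y) ^ 2 = ∑ y, (f0 y - f1 y) ^ 2 :=
      Finset.sum_congr rfl fun y _ => by ring
    simp only [Finset.sum_sub_distrib, Finset.card_univ, Fintype.card_fun, Fintype.card_fin,
      Nat.cast_pow, Nat.cast_ofNat] at hcs
    simp only [f0, f1] at *
    rw [hsymm]
    ring_nf at *
    nlinarith

/-- The hypercube has edge expansion at least one. -/
theorem card_le_card_edgeBoundary (P : Finset (Fin m → Fin 2)) (hP : 2 * P.card ≤ 2 ^ m) :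
    P.card ≤ ((P ×ˢ Finset.univ).filter fun q : (Fin m → Fin 2) × Fin m =>
      flipAt q.1 q.2 ∉ P).card := by
  have hp := poincare_cube fun x => if x ∈ P then (1 : ℝ) else 0
  set b := ((P ×ˢ Finset.univ).filter fun q : (Fin m → Fin 2) × Fin m => flipAt q.1 q.2 ∉ P).card
    with hb
  have hb' : ∑ i : Fin m, ∑ x, (if x ∈ P ∧ flipAt x i ∉ P then (1 : ℝ) else 0) = b := by
    rw [Finset.sum_comm, ← Fintype.sum_prod_type', Finset.sum_boole, hb]
    congr 2
    ext q
    simp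
  have hsum : ∑ x, ∑ i, ((if x ∈ P then (1 : ℝ) else 0) - if flipAt x i ∈ P then 1 else 0) ^ 2
      = 2 * (b : ℝ) := by
    rw [Finset.sum_comm, two_mul, ← hb', ← Finset.sum_add_distrib]
    refine Finset.sum_congr rfl fun i _ => ?_
    have hflip : ∑ x, (if x ∈ P ∧ flipAt x i ∉ P then (1 : ℝ) else 0)
        = ∑ x, if flipAt x i ∈ P ∧ x ∉ P then (1 : ℝ) else 0 := by
      have hinv : Function.Involutive fun x : Fin m → Fin 2 => flipAt x i :=
        fun x => flipAt_flipAt x i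
      rw [← hinv.bijective.sum_comp]
      simp only [flipAt_flipAt]
    nth_rewrite 2 [hflip]
    rw [← Finset.sum_add_distrib]
    refine Finset.sum_congr rfl fun x _ => ?_
    by_cases h1 : x ∈ P <;> by_cases h2 : flipAt x i ∈ P <;> simp [h1, h2]
  rw [hsum] at hp
  have hsq : ∀ x, (if x ∈ P then (1 : ℝ) else 0) ^ 2 = if x ∈ P then (1 : ℝ) else 0 := by
    intro x; split_ifs <;> norm_num
  have hc : ∑ x, (if x ∈ P then (1 : ℝ) else 0) = P.card := by simp
  simp only [hsq, hc] at hp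
  have hP' : 2 * (P.card : ℝ) ≤ 2 ^ m := by exact_mod_cast hP
  have hpow : (0 : ℝ) < 2 ^ m := by positivity
  have : (P.card : ℝ) ≤ b := by
    by_contra hlt
    push Not at hlt
    have : (P.card : ℝ) * P.card * 2 ≤ P.card * 2 ^ m := by
      have : (0 : ℝ) ≤ P.card := by positivity
      nlinarith
    nlinarith [mul_lt_mul_of_pos_left hlt hpow]
  exact_mod_cast this

end Hypercube

section Fibres

variable {V : Type*} [DecidableEq V] {m : ℕ} {key : V → Fin m → Fin 2} {E : V → V → Prop}

/-- The number of `E`-edges leaving `S` dominates the number of fibres that meet `S`, provided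
at most half of the fibres are contained in `S`. -/
theorem card_fibres_le_card_cut {U S : Finset V}
    (hsymm : ∀ u v, E u v → E v u)
    (hnbr : ∀ u ∈ U, ∀ i, ∃ v ∈ U, key v = flipAt (key u) i ∧ E u v)
    (hconn : ∀ u ∈ S, ∀ y ∈ U \ S, key u = key y →
      ∃ u' ∈ S, ∃ v' ∈ U \ S, key u' = key u ∧ key v' = key u ∧ E u' v')
    (hhalf : 2 * (Finset.univ.filter fun x => ∀ u ∈ U, key u = x → u ∈ S).card ≤ 2 ^ m) :
    (S.image key).card ≤ ((S ×ˢ (U \ S)).filter fun e => E e.1 e.2).card := by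
  set P := Finset.univ.filter fun x => ∀ u ∈ U, key u = x → u ∈ S with hP
  set A := (P ×ˢ Finset.univ).filter fun q : (Fin m → Fin 2) × Fin m => flipAt q.1 q.2 ∉ P with hA
  have hPA : P.card ≤ A.card := card_le_card_edgeBoundary P hhalf
  let M := S.image key \ P
  let A' := A.image fun q => (q.1, flipAt q.1 q.2)
  let M' := M.image fun x => (x, x)
  have hA' : A'.card = A.card := Finset.card_image_of_injective _ fun q r h => by
    obtain ⟨h1, h2⟩ := Prod.mk.injEq .. ▸ h
    rw [← h1] at h2
    exact Prod.ext h1 (flipAt_left_injective _ h2)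
  have hM' : M'.card = M.card := Finset.card_image_of_injective _ fun x y h => congrArg Prod.fst h
  have hdisj : Disjoint A' M' := by
    rw [Finset.disjoint_left]
    intro e he he'
    obtain ⟨q, -, rfl⟩ := Finset.mem_image.1 he
    obtain ⟨x, -, hx⟩ := Finset.mem_image.1 he'
    obtain ⟨h1, h2⟩ := Prod.mk.injEq .. ▸ hx
    exact flipAt_ne q.1 q.2 (h2.symm.trans h1)
  have hsub : A' ∪ M' ⊆
      ((S ×ˢ (U \ S)).filter fun e => E e.1 e.2).image fun e => (key e.1, key e.2) := by
    refine Finset.union_subset (fun e he => ?_) fun e he => ?_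
    · obtain ⟨⟨x, i⟩, hq, rfl⟩ := Finset.mem_image.1 he
      simp only [hA, hP, Finset.mem_filter, Finset.mem_product, Finset.mem_univ, and_true, true_and,
        not_forall] at hq
      obtain ⟨hx, v, hvU, hv, hvS⟩ := hq
      obtain ⟨u, huU, hu, huv⟩ := hnbr v hvU i
      rw [hv, flipAt_flipAt] at hu
      refine Finset.mem_image.2 ⟨(u, v), ?_, by simp [hu, hv]⟩
      simp only [Finset.mem_filter, Finset.mem_product, Finset.mem_sdiff]
      exact ⟨⟨hx u huU hu, hvU, hvS⟩, hsymm _ _ huv⟩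
    · obtain ⟨x, hx, rfl⟩ := Finset.mem_image.1 he
      simp only [M, hP, Finset.mem_sdiff, Finset.mem_image, Finset.mem_filter, Finset.mem_univ,
        true_and, not_forall] at hx
      obtain ⟨⟨u, huS, rfl⟩, y, hyU, hyu, hyS⟩ := hx
      obtain ⟨u', hu', v', hv', h1, h2, h3⟩ :=
        hconn u huS y (Finset.mem_sdiff.2 ⟨hyU, hyS⟩) hyu.symm
      exact Finset.mem_image.2 ⟨(u', v'), 
        Finset.mem_filter.2 ⟨Finset.mem_product.2 ⟨hu', hv'⟩, h3⟩, by simp [h1, h2]⟩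
  calc (S.image key).card ≤ P.card + M.card := by
        have : (S.image key).card ≤ M.card + P.card := Finset.card_le_card_sdiff_add_card
        omega
    _ ≤ A'.card + M'.card := by omega
    _ = (A' ∪ M').card := (Finset.card_union_of_disjoint hdisj).symm
    _ ≤ _ := (Finset.card_le_card hsub).trans Finset.card_image_le

theorem card_le_mul_card_cut {U S : Finset V} {B : ℕ} (hS : S ⊆ U)
    (hsymm : ∀ u v, E u v → E v u)
    (hne : ∀ x, ∃ u ∈ U, key u = x)
    (hB : ∀ x, (U.filter fun u => key u = x).card ≤ B)
    (hnbr : ∀ u ∈ U, ∀ i, ∃ v ∈ U, key v = flipAt (key u) i ∧ E u v)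
    (hconn : ∀ T ⊆ U, ∀ u ∈ T, ∀ y ∈ U \ T, key u = key y →
      ∃ u' ∈ T, ∃ v' ∈ U \ T, key u' = key u ∧ key v' = key u ∧ E u' v')
    (hhalf : 2 * S.card ≤ U.card) :
    S.card ≤ B * ((S ×ˢ (U \ S)).filter fun e => E e.1 e.2).card := by
  have hcard : ∀ T ⊆ U, T.card ≤ B * (T.image key).card := fun T hT =>
    Finset.card_le_mul_card_image T B fun x _ =>
      (Finset.card_le_card (Finset.filter_subset_filter _ hT)).trans (hB x)
  by_cases hP : 2 * (Finset.univ.filter fun x => ∀ u ∈ U, key u = x → u ∈ S).card ≤ 2 ^ m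
  · exact (hcard S hS).trans (Nat.mul_le_mul_left _
      (card_fibres_le_card_cut hsymm hnbr (hconn S hS) hP))
  · have hdisj : Disjoint (Finset.univ.filter fun x => ∀ u ∈ U, key u = x → u ∈ S)
        (Finset.univ.filter fun x => ∀ u ∈ U, key u = x → u ∈ U \ S) := by
      rw [Finset.disjoint_left]
      intro x h1 h2
      simp only [Finset.mem_filter, Finset.mem_univ, true_and] at h1 h2
      obtain ⟨u, huU, hu⟩ := hne x
      exact (Finset.mem_sdiff.1 (h2 u huU hu)).2 (h1 u huU hu)
    have hle := Finset.card_le_univ ((Finset.univ.filter fun x => ∀ u ∈ U, key u = x → u ∈ S) ∪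
        (Finset.univ.filter fun x => ∀ u ∈ U, key u = x → u ∈ U \ S))
    rw [Finset.card_union_of_disjoint hdisj, Fintype.card_fun, Fintype.card_fin,
      Fintype.card_fin] at hle
    have hsd : U \ (U \ S) = S := Finset.sdiff_sdiff_eq_self hS
    have h := card_fibres_le_card_cut (S := U \ S) hsymm hnbr
      (hconn _ Finset.sdiff_subset) (by omega)
    rw [hsd] at h
    have hswap : (((U \ S) ×ˢ S).filter fun e => E e.1 e.2).card
        ≤ ((S ×ˢ (U \ S)).filter fun e => E e.1 e.2).card := by
      refine Finset.card_le_card_of_injOn Prod.swap (fun e he => ?_) Prod.swap_injective.injOn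
      simp only [Finset.coe_filter, Finset.mem_product, Set.mem_ofPred_eq, Prod.fst_swap,
        Prod.snd_swap] at he ⊢
      exact ⟨⟨he.1.2, he.1.1⟩, hsymm _ _ he.2⟩
    have h2 := hcard (U \ S) Finset.sdiff_subset
    have h3 := Finset.card_sdiff_add_card_eq_card hS
    calc S.card ≤ (U \ S).card := by omega
      _ ≤ B * ((U \ S).image key).card := h2
      _ ≤ _ := Nat.mul_le_mul_left _ (h.trans hswap)

end Fibres

section Expansion

variable {d m : ℕ}

/-- The restriction of a point of `{0,1}^d` to its first `m` coordinates. -/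
def cubeKey (hm : m ≤ d) (w : Fin d → Fin 2) : Fin m → Fin 2 := fun i => w (Fin.castLE hm i)

theorem expansionAtLeast_of_fibres (hm : m ≤ d) {U : Finset (Fin d → Fin 2)} {B : ℕ}
    (hBpos : 0 < B)
    (hne : ∀ x, ∃ u ∈ U, cubeKey hm u = x)
    (hB : ∀ x, (U.filter fun u => cubeKey hm u = x).card ≤ B) :
    ExpansionAtLeast (convexHull ℝ (toCube '' (U : Set (Fin d → Fin 2)))) (1 / B) := by
  set X := toCube '' (U : Set (Fin d → Fin 2))
  have hXfin : X.Finite := U.finite_toSet.image _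
  intro S hSX _ hhalf
  rw [polyVerts_convexHull_toCube] at hSX hhalf
  let T := U.filter fun w => toCube w ∈ S
  have hTS : S = toCube '' (T : Set (Fin d → Fin 2)) := by
    ext v
    constructor
    · intro hv
      obtain ⟨u, hu, rfl⟩ := hSX hv
      exact ⟨u, by simpa [T] using ⟨hu, hv⟩, rfl⟩
    · rintro ⟨u, hu, rfl⟩
      exact (Finset.mem_filter.1 (Finset.mem_coe.1 hu)).2
  have hTcard : S.ncard = T.card := by
    rw [hTS, Set.ncard_image_of_injective _ toCube_injective, Set.ncard_coe_finset]
  have hUcard : (toCube '' (U : Set (Fin d → Fin 2))).ncard = U.card := by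
    rw [Set.ncard_image_of_injective _ toCube_injective, Set.ncard_coe_finset]
  rw [hTcard, hUcard] at hhalf
  let E : (Fin d → Fin 2) → (Fin d → Fin 2) → Prop := fun u v =>
    IsEdgeOf (convexHull ℝ X) (toCube u) (toCube v)
  have hmain := card_le_mul_card_cut (key := cubeKey hm) (E := E) (S := T) (B := B)
    (Finset.filter_subset _ _) (fun _ _ h => h.symm) hne hB ?_ ?_ hhalf
  · have hcut : ((T ×ˢ (U \ T)).filter fun e => E e.1 e.2).card ≤ cutCard (convexHull ℝ X) S := by
      rw [← Set.ncard_coe_finset, ← Set.ncard_image_of_injective _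
        (toCube_injective.prodMap toCube_injective)]
      refine Set.ncard_le_ncard ?_ ((hXfin.prod hXfin).subset ?_)
      · rintro _ ⟨⟨u, v⟩, he, rfl⟩
        simp only [Finset.coe_filter, Finset.mem_product, Finset.mem_sdiff, Set.mem_ofPred_eq,
          T, Finset.mem_filter, not_and] at he
        exact ⟨he.2, he.1.1.2, he.1.2.2 he.1.2.1⟩
      · rintro ⟨u, v⟩ h
        exact ⟨h.1.symm.right_mem_of_convexHull, h.1.right_mem_of_convexHull⟩
    rw [hTcard, one_div, inv_mul_le_iff₀ (by exact_mod_cast hBpos)]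
    exact_mod_cast hmain.trans (Nat.mul_le_mul_left _ hcut)
  · intro u hu i
    obtain ⟨y, hy, hyk⟩ := hne (flipAt (cubeKey hm u) i)
    let F : (Fin d → Fin 2) → Prop := fun w => ∀ j, j ≠ i → cubeKey hm w j = cubeKey hm u j
    have hF : ∀ a b x, F a → F b → (∀ j, x j = a j ∨ x j = b j) → F x := by
      intro a b x ha hb h j hj
      rcases h (Fin.castLE hm j) with h' | h'
      · exact h'.trans (ha j hj)
      · exact h'.trans (hb j hj)
    have hsum : ∀ w : Fin d → Fin 2, (∑ j, (if j = Fin.castLE hm i then cubeSign u j else 0) *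
        (toCube w j - toCube u j)) =
        if cubeKey hm w i = cubeKey hm u i then (0 : ℝ) else 1 := by
      intro w
      simp only [ite_mul, zero_mul, Finset.sum_ite_eq', Finset.mem_univ, if_true, cubeSign_mul_sub]
      rfl
    obtain ⟨v, hv, hFv, hpos, hE⟩ := exists_improving_edge hF hu (fun _ _ => rfl) hy
      (fun j hj => by rw [hyk, flipAt, Function.update_of_ne hj])
      (fun j => if j = Fin.castLE hm i then cubeSign u j else 0) (by
        rw [hsum, hyk, if_neg (flipAt_apply_ne _ _)]; exact one_pos)
    rw [hsum] at hpos
    refine ⟨v, hv, eq_flipAt (fun h => ?_) hFv, hE⟩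
    rw [if_pos h] at hpos
    exact lt_irrefl _ hpos
  · intro T' hT' u hu y hy huy
    obtain ⟨u', hu', hmin⟩ := Finset.exists_min_image
      (T'.filter fun w => cubeKey hm w = cubeKey hm u)
      (fun w => ∑ j, cubeSign y j * toCube w j) ⟨u, by simp [hu]⟩
    rw [Finset.mem_filter] at hu'
    rw [Finset.mem_sdiff] at hy
    have hne' : u' ≠ y := fun h => hy.2 (h ▸ hu'.1)
    have hlt := dot_cubeSign_lt hne'
    have hF : ∀ a b x, cubeKey hm a = cubeKey hm u → cubeKey hm b = cubeKey hm u →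
        (∀ j, x j = a j ∨ x j = b j) → cubeKey hm x = cubeKey hm u := by
      intro a b x ha hb h
      funext j
      rcases h (Fin.castLE hm j) with h' | h'
      · exact h'.trans (congrFun ha j)
      · exact h'.trans (congrFun hb j)
    obtain ⟨v, hv, hFv, hpos, hE⟩ := exists_improving_edge hF (hT' hu'.1) hu'.2 hy.1 huy.symm
      (fun j => -cubeSign y j) (by
        simp only [neg_mul, mul_sub, Finset.sum_neg_distrib, Finset.sum_sub_distrib]
        linarith)
    refine ⟨u', hu'.1, v, Finset.mem_sdiff.2 ⟨hv, fun hvT => ?_⟩, hu'.2, hFv, hE⟩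
    have := hmin v (Finset.mem_filter.2 ⟨hvT, hFv⟩)
    simp only [neg_mul, mul_sub, Finset.sum_neg_distrib, Finset.sum_sub_distrib] at hpos
    linarith

end Expansion

section Counting

theorem descFactorial_mul_pow_le {a N : ℕ} (h : a ≤ N) (t : ℕ) :
    a.descFactorial t * N ^ t ≤ a ^ t * N.descFactorial t := by
  induction t with
  | zero => simp
  | succ t ih =>
    have hstep : (a - t) * N ≤ a * (N - t) := by
      rw [Nat.sub_mul, Nat.mul_sub]
      have : a * t ≤ t * N := by rw [mul_comm]; exact Nat.mul_le_mul_left _ h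
      omega
    calc a.descFactorial (t + 1) * N ^ (t + 1)
        = ((a - t) * N) * (a.descFactorial t * N ^ t) := by
          rw [Nat.descFactorial_succ]; ring
      _ ≤ (a * (N - t)) * (a ^ t * N.descFactorial t) := Nat.mul_le_mul hstep ih
      _ = a ^ (t + 1) * N.descFactorial (t + 1) := by
          rw [Nat.descFactorial_succ]; ring

theorem choose_mul_pow_le {a N : ℕ} (h : a ≤ N) (t : ℕ) :
    a.choose t * N ^ t ≤ a ^ t * N.choose t := by
  have := descFactorial_mul_pow_le h t
  rw [Nat.descFactorial_eq_factorial_mul_choose, Nat.descFactorial_eq_factorial_mul_choose] at this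
  refine Nat.le_of_mul_le_mul_left ?_ t.factorial_pos
  linarith

variable {V : Type*} [Fintype V] [DecidableEq V]

theorem card_filter_disjoint_le (F : Finset V) (n : ℕ) :
    ((((Finset.univ : Finset V).powersetCard n).filter fun U => Disjoint U F).card : ℝ) ≤
      Real.exp (-(n * F.card / Fintype.card V)) * (Fintype.card V).choose n := by
  have heq : (((Finset.univ : Finset V).powersetCard n).filter fun U => Disjoint U F)
      = (Fᶜ).powersetCard n := by
    ext U
    simp only [Finset.mem_filter, Finset.mem_powersetCard, Finset.subset_univ, true_and,
      Finset.subset_compl_iff_disjoint_right, and_comm]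
  rw [heq, Finset.card_powersetCard]
  rcases isEmpty_or_nonempty V with hV | hV
  · simp [Finset.card_compl]
  set N := Fintype.card V
  have hN : (0 : ℝ) < N := by exact_mod_cast Fintype.card_pos
  have h : ((Fᶜ.card.choose n : ℕ) : ℝ) * N ^ n ≤ (Fᶜ.card : ℝ) ^ n * N.choose n := by
    exact_mod_cast choose_mul_pow_le (Finset.card_le_univ Fᶜ) n
  have hq : (Fᶜ.card : ℝ) / N ≤ Real.exp (-(F.card / N)) := by
    refine le_trans (le_of_eq ?_) (Real.one_sub_le_exp_neg _)
    rw [Finset.card_compl, Nat.cast_sub (Finset.card_le_univ F), sub_div, div_self hN.ne']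
  calc ((Fᶜ.card.choose n : ℕ) : ℝ) ≤ ((Fᶜ.card : ℝ) / N) ^ n * N.choose n := by
        rw [div_pow, div_mul_eq_mul_div, le_div_iff₀ (by positivity)]
        exact h
    _ ≤ Real.exp (-(F.card / N)) ^ n * N.choose n := by gcongr
    _ = _ := by rw [← Real.exp_nat_mul]; congr 2; ring

theorem card_filter_superset_le (T : Finset V) (n : ℕ) :
    (((Finset.univ : Finset V).powersetCard n).filter fun U => T ⊆ U).card ≤
      (Fintype.card V - T.card).choose (n - T.card) := by
  rw [← Finset.card_compl, ← Finset.card_powersetCard]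
  refine Finset.card_le_card_of_injOn (fun U => U \ T) (fun U hU => ?_) fun U hU U' hU' h => ?_
  · simp only [Finset.coe_filter, Finset.mem_powersetCard, Set.mem_ofPred_eq] at hU
    simp only [Finset.mem_coe, Finset.mem_powersetCard, Finset.subset_compl_iff_disjoint_right]
    exact ⟨Finset.sdiff_disjoint, by rw [Finset.card_sdiff_of_subset hU.2, hU.1.2]⟩
  · simp only [Finset.coe_filter, Set.mem_ofPred_eq] at hU hU' h
    rw [← Finset.sdiff_union_of_subset hU.2, ← Finset.sdiff_union_of_subset hU'.2, h]

theorem card_filter_le_card_inter_le (F : Finset V) {n : ℕ} (hn : n ≤ Fintype.card V) (t : ℕ) :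
    (((Finset.univ : Finset V).powersetCard n).filter fun U => t ≤ (U ∩ F).card).card *
        Fintype.card V ^ t * t.factorial ≤
      (F.card * n) ^ t * (Fintype.card V).choose n := by
  set N := Fintype.card V
  set X := ((Finset.univ : Finset V).powersetCard n).filter fun U => t ≤ (U ∩ F).card with hX
  rcases lt_or_ge n t with hnt | htn
  · have : X = ∅ := by
      rw [hX, Finset.filter_eq_empty_iff]
      intro U hU
      rw [Finset.mem_powersetCard] at hU
      have := Finset.card_le_card (Finset.inter_subset_left (s₁ := U) (s₂ := F))
      omega
    simp [this]
  have h1 : X.card ≤ F.card.choose t * (N - t).choose (n - t) := by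
    have hsub : X ⊆ (F.powersetCard t).biUnion fun T =>
        ((Finset.univ : Finset V).powersetCard n).filter fun U => T ⊆ U := by
      intro U hU
      rw [hX, Finset.mem_filter] at hU
      obtain ⟨T, hT, hTc⟩ := Finset.exists_subset_card_eq hU.2
      rw [Finset.subset_inter_iff] at hT
      exact Finset.mem_biUnion.2 ⟨T, Finset.mem_powersetCard.2 ⟨hT.2, hTc⟩,
        Finset.mem_filter.2 ⟨hU.1, hT.1⟩⟩
    refine (Finset.card_le_card hsub).trans ((Finset.card_biUnion_le_card_mul _ _
      ((N - t).choose (n - t)) fun T hT => ?_).trans_eq ?_)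
    · rw [← (Finset.mem_powersetCard.1 hT).2]
      exact card_filter_superset_le T n
    · rw [Finset.card_powersetCard]
  have h2 : N.choose n * n.choose t = N.choose t * (N - t).choose (n - t) := Nat.choose_mul htn
  have h3 := choose_mul_pow_le hn t
  have h4 : F.card.choose t * t.factorial ≤ F.card ^ t := by
    rw [mul_comm, ← Nat.descFactorial_eq_factorial_mul_choose]
    exact Nat.descFactorial_le_pow _ _
  refine Nat.le_of_mul_le_mul_left ?_ (Nat.choose_pos (htn.trans hn))
  calc N.choose t * (X.card * N ^ t * t.factorial)
      ≤ N.choose t * (F.card.choose t * (N - t).choose (n - t) * N ^ t * t.factorial) := by gcongr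
    _ = (N.choose t * (N - t).choose (n - t)) * N ^ t * (F.card.choose t * t.factorial) := by ring
    _ = N.choose n * (n.choose t * N ^ t) * (F.card.choose t * t.factorial) := by rw [← h2]; ring
    _ ≤ N.choose n * (n ^ t * N.choose t) * F.card ^ t := by gcongr
    _ = N.choose t * ((F.card * n) ^ t * N.choose n) := by rw [mul_pow]; ring

theorem pow_div_factorial_le_exp_neg {d : ℕ} (hd : 0 < d) :
    (2 * d : ℝ) ^ (12 * d) / (12 * d).factorial ≤ Real.exp (-d) := by
  have hd' : (0 : ℝ) < d := by exact_mod_cast hd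
  have h1 := Real.pow_div_factorial_le_exp (x := 12 * d) (by positivity) (12 * d)
  have hbase : (1 / 6 : ℝ) ^ 12 * Real.exp 12 ≤ Real.exp (-1) := by
    have h3 : Real.exp 13 ≤ 3 ^ 13 := by
      have : Real.exp 13 = Real.exp 1 ^ 13 := by rw [← Real.exp_nat_mul]; norm_num
      rw [this]
      gcongr
      exact Real.exp_one_lt_three.le
    have h4 : Real.exp 12 = Real.exp 13 * Real.exp (-1) := by rw [← Real.exp_add]; norm_num
    rw [h4, ← mul_assoc]
    refine mul_le_of_le_one_left (Real.exp_pos _).le ?_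
    calc (1 / 6 : ℝ) ^ 12 * Real.exp 13 ≤ (1 / 6 : ℝ) ^ 12 * 3 ^ 13 := by gcongr
      _ ≤ 1 := by norm_num
  calc (2 * d : ℝ) ^ (12 * d) / (12 * d).factorial
      = (1 / 6) ^ (12 * d) * ((12 * d : ℝ) ^ (12 * d) / (12 * d).factorial) := by
        rw [← mul_div_assoc, ← mul_pow]; congr 2; ring
    _ ≤ (1 / 6) ^ (12 * d) * Real.exp (12 * d) := by gcongr
    _ = ((1 / 6 : ℝ) ^ 12 * Real.exp 12) ^ d := by
        rw [mul_pow, ← pow_mul, ← Real.exp_nat_mul]; congr 2; ring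
    _ ≤ Real.exp (-1) ^ d := by gcongr
    _ = Real.exp (-d) := by rw [← Real.exp_nat_mul]; congr 1; ring

variable {d m : ℕ}

theorem card_cubeKey_fibre (hm : m ≤ d) (x : Fin m → Fin 2) :
    (Finset.univ.filter fun w => cubeKey hm w = x).card = 2 ^ (d - m) := by
  obtain ⟨k, rfl⟩ := Nat.exists_eq_add_of_le hm
  have hcard : 2 ^ (m + k - m) = (Finset.univ : Finset (Fin k → Fin 2)).card := by simp
  rw [hcard]
  refine Finset.card_nbij' (fun w j => w (Fin.natAdd m j)) (fun y => Fin.append x y)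
    (fun _ _ => by simp) (fun y _ => ?_) (fun w hw => ?_) (fun y _ => ?_)
  · simp only [Finset.coe_filter, Finset.mem_univ, true_and, Set.mem_ofPred_eq]
    funext i
    exact Fin.append_left x y i
  · simp only [Finset.coe_filter, Finset.mem_univ, true_and, Set.mem_ofPred_eq] at hw
    subst hw
    exact Fin.append_castAdd_natAdd
  · funext j
    exact Fin.append_right x y j

/-- If the mean size of a fibre lies in `[d, 2d]`, then a fibre is empty or has more than `12d`
elements with probability at most `2 exp (-d)`. -/
theorem card_bad_fibre_le (hd : 0 < d) (hm : m ≤ d) {n : ℕ} (hn : n ≤ 2 ^ d)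
    (hlow : d * 2 ^ m ≤ n) (hup : n ≤ 2 * d * 2 ^ m) (x : Fin m → Fin 2) :
    ((((Finset.univ : Finset (Fin d → Fin 2)).powersetCard n).filter fun U =>
        (∀ u ∈ U, cubeKey hm u ≠ x) ∨
          12 * d < (U.filter fun u => cubeKey hm u = x).card).card : ℝ) ≤
      2 * Real.exp (-d) * (2 ^ d).choose n := by
  set F := Finset.univ.filter fun w => cubeKey hm w = x with hF
  have hFc : F.card = 2 ^ (d - m) := card_cubeKey_fibre hm x
  have hV : Fintype.card (Fin d → Fin 2) = 2 ^ d := by simp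
  have hpow : (2 : ℝ) ^ d = 2 ^ (d - m) * 2 ^ m := by rw [← pow_add, Nat.sub_add_cancel hm]
  have hmean : (n * F.card / Fintype.card (Fin d → Fin 2) : ℝ) = n / 2 ^ m := by
    rw [hFc, hV]
    push_cast
    rw [hpow]
    field_simp
  have hlow' : (d : ℝ) ≤ n / 2 ^ m := by
    rw [le_div_iff₀ (by positivity)]; exact_mod_cast hlow
  have hup' : (n / 2 ^ m : ℝ) ≤ 2 * d := by
    rw [div_le_iff₀ (by positivity)]; exact_mod_cast hup
  have h1 := card_filter_disjoint_le F n
  have h2 := card_filter_le_card_inter_le F (hn.trans_eq hV.symm) (12 * d)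
  rw [hmean, hV] at h1
  have h1' : ((((Finset.univ : Finset (Fin d → Fin 2)).powersetCard n).filter fun U =>
      Disjoint U F).card : ℝ) ≤ Real.exp (-d) * (2 ^ d).choose n := by
    refine h1.trans ?_
    gcongr
  have h2' : ((((Finset.univ : Finset (Fin d → Fin 2)).powersetCard n).filter fun U =>
      12 * d ≤ (U ∩ F).card).card : ℝ) ≤ Real.exp (-d) * (2 ^ d).choose n := by
    refine le_trans ?_ (mul_le_mul_of_nonneg_right (pow_div_factorial_le_exp_neg hd)
      (Nat.cast_nonneg _))
    have h3 : (n * F.card / Fintype.card (Fin d → Fin 2) : ℝ) ^ (12 * d) ≤ (2 * d) ^ (12 * d) := by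
      rw [hmean]; gcongr
    refine le_trans ?_ (mul_le_mul_of_nonneg_right
      (div_le_div_of_nonneg_right h3 (Nat.cast_nonneg _)) (Nat.cast_nonneg _))
    have hNpos : (0 : ℝ) < (Fintype.card (Fin d → Fin 2) : ℝ) := by rw [hV]; positivity
    rw [div_pow, div_div, div_mul_eq_mul_div, le_div_iff₀ (by positivity), ← mul_assoc,
      mul_comm (n : ℝ), ← hV]
    exact_mod_cast h2
  have hsub : (((Finset.univ : Finset (Fin d → Fin 2)).powersetCard n).filter fun U =>
        (∀ u ∈ U, cubeKey hm u ≠ x) ∨ 12 * d < (U.filter fun u => cubeKey hm u = x).card) ⊆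
      (((Finset.univ : Finset (Fin d → Fin 2)).powersetCard n).filter fun U => Disjoint U F) ∪
      (((Finset.univ : Finset (Fin d → Fin 2)).powersetCard n).filter fun U =>
        12 * d ≤ (U ∩ F).card) := by
    intro U hU
    rw [Finset.mem_filter] at hU
    rw [Finset.mem_union, Finset.mem_filter, Finset.mem_filter]
    refine hU.2.imp (fun h => ⟨hU.1, ?_⟩) fun h => ⟨hU.1, ?_⟩
    · rw [Finset.disjoint_left]
      exact fun u hu huF => h u hu (Finset.mem_filter.1 huF).2
    · have : U ∩ F = U.filter fun u => cubeKey hm u = x := by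
        ext u; simp [hF]
      rw [this]
      exact h.le
  have h3 := (Finset.card_le_card hsub).trans (Finset.card_union_le _ _)
  have h3' : ((((Finset.univ : Finset (Fin d → Fin 2)).powersetCard n).filter fun U =>
        (∀ u ∈ U, cubeKey hm u ≠ x) ∨
          12 * d < (U.filter fun u => cubeKey hm u = x).card).card : ℝ) ≤ _ := Nat.cast_le.2 h3
  rw [Nat.cast_add] at h3'
  linarith

theorem expansion_prob_ge (hd : 0 < d) {n : ℕ} (hn1 : 1 ≤ n) (hn : n ≤ 2 ^ d) :
    1 - 2 * (2 * Real.exp (-1)) ^ d ≤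
      (((((Finset.univ : Finset (Fin d → Fin 2)).powersetCard n).filter
          fun U : Finset (Fin d → Fin 2) => ExpansionAtLeast
            (convexHull ℝ (toCube '' (U : Set (Fin d → Fin 2))))
            (1 / (12 * (d : ℝ)))).card : ℝ)
        / (((Finset.univ : Finset (Fin d → Fin 2)).powersetCard n).card : ℝ)) := by
  set Ω := (Finset.univ : Finset (Fin d → Fin 2)).powersetCard n with hΩ
  have hΩc : Ω.card = (2 ^ d).choose n := by simp [hΩ, Finset.card_powersetCard]
  have hΩpos : (0 : ℝ) < Ω.card := by
    rw [hΩc]; exact_mod_cast Nat.choose_pos hn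
  have hgood : ∀ {m : ℕ} (hm : m ≤ d) (U : Finset (Fin d → Fin 2)),
      (∀ x, ∃ u ∈ U, cubeKey hm u = x) →
      (∀ x, (U.filter fun u => cubeKey hm u = x).card ≤ 12 * d) →
      ExpansionAtLeast (convexHull ℝ (toCube '' (U : Set (Fin d → Fin 2))))
        (1 / (12 * (d : ℝ))) := by
    intro m hm U h1 h2
    have := expansionAtLeast_of_fibres hm (by positivity) h1 h2
    push_cast at this
    exact this
  rw [le_div_iff₀ hΩpos]
  rcases lt_or_ge n d with hnd | hnd
  · rw [Finset.filter_true_of_mem]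
    · have : (0 : ℝ) ≤ 2 * (2 * Real.exp (-1)) ^ d := by positivity
      nlinarith
    · intro U hU
      rw [hΩ, Finset.mem_powersetCard] at hU
      refine hgood (Nat.zero_le d) U (fun x => ?_) fun x => ?_
      · obtain ⟨u, hu⟩ := Finset.card_pos.1 (hU.2.symm ▸ hn1 : 0 < U.card)
        exact ⟨u, hu, Subsingleton.elim _ _⟩
      · have := Finset.card_filter_le U fun u => cubeKey (Nat.zero_le d) u = x
        omega
  · set m := Nat.log 2 (n / d)
    have hq : n / d ≠ 0 := (Nat.div_pos hnd hd).ne'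
    have hlow : 2 ^ m ≤ n / d := Nat.pow_log_le_self 2 hq
    have hup : n / d < 2 ^ (m + 1) := Nat.lt_pow_succ_log_self one_lt_two _
    have hm : m ≤ d := (Nat.pow_le_pow_iff_right one_lt_two).1
      (hlow.trans ((Nat.div_le_self _ _).trans hn))
    have hlow' : d * 2 ^ m ≤ n := by
      rw [mul_comm]; exact (Nat.le_div_iff_mul_le hd).1 hlow
    have hup' : n ≤ 2 * d * 2 ^ m := by
      have := (Nat.div_lt_iff_lt_mul hd).1 hup
      rw [pow_succ] at this
      linarith
    set good := fun U : Finset (Fin d → Fin 2) => ExpansionAtLeast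
      (convexHull ℝ (toCube '' (U : Set (Fin d → Fin 2)))) (1 / (12 * (d : ℝ)))
    have hbad : Ω.filter (fun U => ¬ good U) ⊆ Finset.univ.biUnion fun x => Ω.filter fun U =>
        (∀ u ∈ U, cubeKey hm u ≠ x) ∨
          12 * d < (U.filter fun u => cubeKey hm u = x).card := by
      intro U hU
      rw [Finset.mem_filter] at hU
      by_contra hcon
      simp only [Finset.mem_biUnion, Finset.mem_univ, true_and, Finset.mem_filter, hU.1,
        not_exists, not_or, not_forall, not_lt, ne_eq, not_not, exists_prop] at hcon
      exact hU.2 (hgood hm U (fun x => (hcon x).1) fun x => (hcon x).2)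
    have hcard : ((Ω.filter fun U => ¬ good U).card : ℝ) ≤
        2 ^ m * (2 * Real.exp (-d) * (2 ^ d).choose n) := by
      calc ((Ω.filter fun U => ¬ good U).card : ℝ)
          ≤ ∑ x : Fin m → Fin 2, ((Ω.filter fun U => (∀ u ∈ U, cubeKey hm u ≠ x) ∨
              12 * d < (U.filter fun u => cubeKey hm u = x).card).card : ℝ) := by
            exact_mod_cast (Finset.card_le_card hbad).trans Finset.card_biUnion_le
        _ ≤ ∑ _x : Fin m → Fin 2, 2 * Real.exp (-d) * (2 ^ d).choose n :=
            Finset.sum_le_sum fun x _ => card_bad_fibre_le hd hm hn hlow' hup' x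
        _ = _ := by simp
    have hsplit : ((Ω.filter good).card : ℝ) + (Ω.filter fun U => ¬ good U).card = Ω.card := by
      exact_mod_cast Finset.card_filter_add_card_filter_not good
    have hpow : (2 : ℝ) ^ m ≤ 2 ^ d := pow_le_pow_right₀ one_le_two hm
    have hexp : (2 * Real.exp (-1)) ^ d = 2 ^ d * Real.exp (-d) := by
      rw [mul_pow, ← Real.exp_nat_mul]; congr 2; ring
    have hfin : 2 ^ m * (2 * Real.exp (-d) * (2 ^ d).choose n) ≤
        2 * (2 * Real.exp (-1)) ^ d * Ω.card := by
      rw [hexp, hΩc]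
      calc 2 ^ m * (2 * Real.exp (-d) * ((2 ^ d).choose n : ℝ))
          ≤ 2 ^ d * (2 * Real.exp (-d) * (2 ^ d).choose n) := by gcongr
        _ = _ := by ring
    linarith

end Counting

/-- Main theorem, uniform model: for `1 ≤ n ≤ 2^d`, let `U` be a uniformly random
`n`-element subset of `{0,1}^d` and `Q = conv U`.  Then with probability tending
to 1 as `d → ∞` (uniformly in `n`), the edge expansion of the graph of `Q` is at
least `1/(12d)`.  Probability is counting probability over all `n`-element subsets. -/
theorem main_uniform :
    ∀ ε : ℝ, 0 < ε → ∃ D : ℕ, ∀ d : ℕ, D ≤ d → ∀ n : ℕ, 1 ≤ n → n ≤ 2 ^ d →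
      1 - ε ≤
        (((((Finset.univ : Finset (Fin d → Fin 2)).powersetCard n).filter
            fun U => ExpansionAtLeast
              (convexHull ℝ (toCube '' (U : Set (Fin d → Fin 2))))
              (1 / (12 * (d : ℝ)))).card : ℝ)
          / (((Finset.univ : Finset (Fin d → Fin 2)).powersetCard n).card : ℝ)) := by
  intro ε hε
  have hlt : 2 * Real.exp (-1) < 1 := by
    rw [Real.exp_neg, ← div_eq_mul_inv, div_lt_one (Real.exp_pos 1)]
    exact lt_trans (by norm_num) Real.exp_one_gt_d9
  have hlim := (tendsto_pow_atTop_nhds_zero_of_lt_one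
    (by positivity : 0 ≤ 2 * Real.exp (-1)) hlt).const_mul 2
  rw [mul_zero] at hlim
  obtain ⟨D, hD⟩ := Filter.eventually_atTop.1 (hlim.eventually (gt_mem_nhds hε))
  refine ⟨max D 1, fun d hd n hn1 hn => ?_⟩
  have h := hD d (le_of_max_le_left hd)
  have hprob := expansion_prob_ge (le_of_max_le_right hd) hn1 hn
  -- in the statement the subsets are coerced to `Set` through the monad structure of `Finset`
  have hcoe : ∀ Ω : Finset (Finset (Fin d → Fin 2)),
      (do let a ← Ω; pure (a : Set (Fin d → Fin 2)) : Finset (Set (Fin d → Fin 2)))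
        = Ω.image fun a : Finset (Fin d → Fin 2) => (a : Set (Fin d → Fin 2)) := by
    intro Ω
    ext U
    simp [Finset.bind_def, eq_comm]
  rw [hcoe, Finset.filter_image, Finset.card_image_of_injective _ Finset.coe_injective]
  linarith
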